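/- Let q₀, q₁ : ℝ → ℝ be continuous compactly supported functions each integrating to zero, and define q(t,x) = q₀(t+x) q₁(t−x) on ℝ^{1+1}. Then the light ray transform of q vanishes identically: for every y ∈ ℝ and v ∈ {−1,1}, ∫_ℝ q(s, y+sv) ds = 0, while q need not be identically zero. -/

import Mathlib

open MeasureTheory

/-- In dimension `n = 1` the light ray transform has a nontrivial kernel:
if `q(t,x) = q₀(t+x) q₁(t-x)` with `q₀, q₁` continuous, compactly supported
and integrating to zero, then all light ray integrals of `q` vanish, while
such `q` need not be identically zero. -/
theorem light_ray_transform_kernel_1d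
    (q₀ q₁ : ℝ → ℝ)
    (h₀c : Continuous q₀) (h₀s : HasCompactSupport q₀) (h₀i : ∫ t : ℝ, q₀ t = 0)
    (h₁c : Continuous q₁) (h₁s : HasCompactSupport q₁) (h₁i : ∫ t : ℝ, q₁ t = 0)
    (q : ℝ → ℝ → ℝ) (hq : ∀ t x, q t x = q₀ (t + x) * q₁ (t - x)) :
    (∀ (y : ℝ) (v : ℝ), v = 1 ∨ v = -1 → ∫ s : ℝ, q s (y + s * v) = 0) ∧
    (∃ p₀ p₁ : ℝ → ℝ,
        Continuous p₀ ∧ HasCompactSupport p₀ ∧ (∫ t : ℝ, p₀ t) = 0 ∧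
        Continuous p₁ ∧ HasCompactSupport p₁ ∧ (∫ t : ℝ, p₁ t) = 0 ∧
        ∃ t x : ℝ, p₀ (t + x) * p₁ (t - x) ≠ 0) := by
  constructor
  · intro y v hv
    rcases hv with rfl | rfl
    · have h : ∀ s : ℝ, q s (y + s * 1) = q₀ (2 * s + y) * q₁ (-y) := by
        intro s
        rw [hq]
        congr 2 <;> ring
      simp_rw [h]
      rw [integral_mul_const, Measure.integral_comp_mul_left (fun u => q₀ (u + y)) 2,
        integral_add_right_eq_self q₀ y, h₀i]
      simp
    · have h : ∀ s : ℝ, q s (y + s * (-1)) = q₀ y * q₁ (2 * s - y) := by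
        intro s
        rw [hq]
        congr 2 <;> ring
      simp_rw [h]
      rw [integral_const_mul, Measure.integral_comp_mul_left (fun u => q₁ (u - y)) 2,
        integral_sub_right_eq_self q₁ y, h₁i]
      simp
  · have key : ∃ p : ℝ → ℝ, Continuous p ∧ HasCompactSupport p ∧ (∫ t : ℝ, p t) = 0 ∧
        p 0 ≠ 0 := by
      let f : ℝ → ℝ := fun t => max 0 (1 - |t|)
      have fc : Continuous f := by fun_prop
      have gc : Continuous (fun t => f (t - 2)) := by fun_prop
      have fs : HasCompactSupport f := by
        refine HasCompactSupport.intro (isCompact_Icc (a := (-1 : ℝ)) (b := 1)) ?_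
        intro x hx
        apply max_eq_left
        by_contra hlt
        exact hx (abs_le.mp (by linarith))
      have gs : HasCompactSupport (fun t => f (t - 2)) :=
        fs.comp_homeomorph (Homeomorph.subRight (2 : ℝ))
      refine ⟨fun t => f t - f (t - 2), fc.sub gc, fs.sub gs, ?_, ?_⟩
      · rw [integral_sub (fc.integrable_of_hasCompactSupport fs)
          (gc.integrable_of_hasCompactSupport gs), integral_sub_right_eq_self f 2, sub_self]
      · norm_num [f]
    obtain ⟨p, h1, h2, h3, h4⟩ := key
    exact ⟨p, p, h1, h2, h3, h1, h2, h3, 0, 0, by simpa using h4⟩
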